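/- For every n ≥ 3, the quantities for consecutive generations of the pseudofractal scale-free web satisfy c_{n+1}^1 = min{3c_n^1, 2c_n^1 + c_n^0, 2c_n^1 + d_n^0, c_n^1 + 2c_n^0, c_n^1 + c_n^0 + d_n^0, b_n^2 + c_n^0 + c_n^1, b_n^2 + c_n^0 + d_n^0, b_n^2 + 2c_n^0, 2b_n^2 + c_n^0, 2b_n^2 + d_n^0, b_n^2 + 2c_n^1, b_n^2 + c_n^1 + d_n^0}. -/

import Mathlib

/-!
Common definitions: the pseudofractal scale-free web `pfw n` (= `G_n` for `n ≥ 1`)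
and the Sierpinski graph `sierp n` (= `S_n` for `n ≥ 1`), together with the
edge-domination notions used in the paper.
-/

open scoped Classical

noncomputable section

/-- A finite graph generation: a finite vertex type, a finite set of edges
(unordered pairs of vertices), and three designated hub/outmost vertices. -/
structure GraphGen : Type 1 where
  V : Type
  fin : Fintype V
  edges : Finset (Sym2 V)
  hubs : Fin 3 → V

attribute [instance] GraphGen.fin

/-- The triangle (complete graph on three vertices), the common first generation. -/
def triangle : GraphGen where
  V := Fin 3
  fin := inferInstance
  edges := {s((0 : Fin 3), (1 : Fin 3)), s((0 : Fin 3), (2 : Fin 3)), s((1 : Fin 3), (2 : Fin 3))}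
  hubs := fun i => i

/-- One iteration step of the pseudofractal scale-free web: for every existing
edge `{u,v}` a new vertex is added and joined to both `u` and `v`. -/
def pfwStep (X : GraphGen) : GraphGen where
  V := X.V ⊕ {e : Sym2 X.V // e ∈ X.edges}
  fin := inferInstance
  edges :=
    X.edges.image (Sym2.map Sum.inl) ∪
      X.edges.attach.biUnion fun e =>
        (Finset.univ.filter fun v : X.V => v ∈ (e : Sym2 X.V)).image fun v =>
          s((Sum.inl v : X.V ⊕ {e : Sym2 X.V // e ∈ X.edges}), Sum.inr e)
  hubs := fun i => Sum.inl (X.hubs i)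

private def pfwAux : ℕ → GraphGen
  | 0 => triangle
  | n + 1 => pfwStep (pfwAux n)

/-- `pfw n` is the pseudofractal scale-free web `G_n` (for `n ≥ 1`):
`G_1` is a triangle and `G_{n+1}` is obtained from `G_n` by adding, for each
edge, a new vertex adjacent to both of its endpoints.  Its hubs are the three
vertices of `G_1`. -/
def pfw (n : ℕ) : GraphGen := pfwAux (n - 1)

/-- The identification relation used to glue three copies of the Sierpinski
graph: `B^(1) ~ A^(2)`, `C^(1) ~ A^(3)`, `C^(2) ~ B^(3)` (copies indexed by
`0, 1, 2` and outmost vertices `A = hubs 0`, `B = hubs 1`, `C = hubs 2`). -/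
def sierpRel (X : GraphGen) : Fin 3 × X.V → Fin 3 × X.V → Prop := fun p q =>
  (p = ((0 : Fin 3), X.hubs 1) ∧ q = ((1 : Fin 3), X.hubs 0)) ∨
  (p = ((0 : Fin 3), X.hubs 2) ∧ q = ((2 : Fin 3), X.hubs 0)) ∨
  (p = ((1 : Fin 3), X.hubs 2) ∧ q = ((2 : Fin 3), X.hubs 1))

/-- One iteration step of the Sierpinski graph: three disjoint copies of the
previous generation are glued along their outmost vertices. -/
def sierpStep (X : GraphGen) : GraphGen where
  V := Quotient (Relation.EqvGen.setoid (sierpRel X))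
  fin := inferInstance
  edges :=
    (Finset.univ : Finset (Fin 3)).biUnion fun t =>
      X.edges.image (Sym2.map fun v => Quotient.mk (Relation.EqvGen.setoid (sierpRel X)) (t, v))
  hubs := fun i => Quotient.mk (Relation.EqvGen.setoid (sierpRel X)) (i, X.hubs i)

private def sierpAux : ℕ → GraphGen
  | 0 => triangle
  | n + 1 => sierpStep (sierpAux n)

/-- `sierp n` is the Sierpinski graph `S_n` (for `n ≥ 1`):
`S_1` is a triangle, and `S_{n+1}` is obtained by gluing three copies of `S_n`
at their outmost vertices.  Its `hubs` are the three outmost vertices. -/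
def sierp (n : ℕ) : GraphGen := sierpAux (n - 1)

/-- An edge `e` is dominated by the edge set `F` if it belongs to `F` or
shares an endpoint with some edge of `F`. -/
def Dominated (X : GraphGen) (F : Finset (Sym2 X.V)) (e : Sym2 X.V) : Prop :=
  e ∈ F ∨ ∃ f ∈ F, ∃ v, v ∈ e ∧ v ∈ f

/-- `F` is an edge dominating set: a set of edges of `X` such that every edge
not in `F` shares an endpoint with some edge of `F`. -/
def IsEDS (X : GraphGen) (F : Finset (Sym2 X.V)) : Prop :=
  F ⊆ X.edges ∧ ∀ e ∈ X.edges, e ∉ F → ∃ f ∈ F, ∃ v, v ∈ e ∧ v ∈ f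

/-- The edge domination number: the minimum cardinality of an edge dominating set. -/
def edsNum (X : GraphGen) : ℕ := sInf {k | ∃ F, IsEDS X F ∧ F.card = k}

/-- A minimum edge dominating set: an EDS whose cardinality equals the edge
domination number. -/
def IsMEDS (X : GraphGen) (F : Finset (Sym2 X.V)) : Prop :=
  IsEDS X F ∧ F.card = edsNum X

/-- Hub number `i` is filled w.r.t. `F`: some edge incident to it lies in `F`. -/
def FilledHub (X : GraphGen) (F : Finset (Sym2 X.V)) (i : Fin 3) : Prop :=
  ∃ f ∈ F, X.hubs i ∈ f

/-- Hub number `i` is cross w.r.t. `F`: no edge incident to it lies in `F` and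
some edge incident to it is not dominated by `F`. -/
def CrossHub (X : GraphGen) (F : Finset (Sym2 X.V)) (i : Fin 3) : Prop :=
  ¬ FilledHub X F i ∧ ∃ e ∈ X.edges, X.hubs i ∈ e ∧ ¬ Dominated X F e

/-- Hub number `i` is empty w.r.t. `F`: it is neither filled nor cross. -/
def EmptyHub (X : GraphGen) (F : Finset (Sym2 X.V)) (i : Fin 3) : Prop :=
  ¬ FilledHub X F i ∧ ¬ CrossHub X F i

/-- `F` is admissible: a set of edges of `X` such that every edge not dominated
by `F` is incident to a cross hub vertex. -/
def Admissible (X : GraphGen) (F : Finset (Sym2 X.V)) : Prop :=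
  F ⊆ X.edges ∧
    ∀ e ∈ X.edges, ¬ Dominated X F e → ∃ i, CrossHub X F i ∧ X.hubs i ∈ e

/-- The number of filled hub vertices w.r.t. `F`. -/
def numFilled (X : GraphGen) (F : Finset (Sym2 X.V)) : ℕ :=
  (Finset.univ.filter fun i : Fin 3 => FilledHub X F i).card

/-- The number of cross hub vertices w.r.t. `F`. -/
def numCross (X : GraphGen) (F : Finset (Sym2 X.V)) : ℕ :=
  (Finset.univ.filter fun i : Fin 3 => CrossHub X F i).card

/-- `minAdm X nf i` is the minimum cardinality of an admissible set with exactly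
`nf` filled hub vertices and exactly `i` cross hub vertices. -/
def minAdm (X : GraphGen) (nf i : ℕ) : ℕ :=
  sInf {k | ∃ F, Admissible X F ∧ numFilled X F = nf ∧ numCross X F = i ∧ F.card = k}

/-- The class of admissible sets with exactly `nf` filled and exactly `i` cross
hub vertices attaining the minimum cardinality among such sets. -/
def admClass (X : GraphGen) (nf i : ℕ) : Set (Finset (Sym2 X.V)) :=
  {F | Admissible X F ∧ numFilled X F = nf ∧ numCross X F = i ∧ F.card = minAdm X nf i}

/-- `a_n^i`: minimum cardinality of an admissible set with no filled hub and `i` cross hubs. -/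
def aq (X : GraphGen) (i : ℕ) : ℕ := minAdm X 0 i

/-- `b_n^i`: minimum cardinality of an admissible set with one filled hub and `i` cross hubs. -/
def bq (X : GraphGen) (i : ℕ) : ℕ := minAdm X 1 i

/-- `c_n^i`: minimum cardinality of an admissible set with two filled hubs and `i` cross hubs. -/
def cq (X : GraphGen) (i : ℕ) : ℕ := minAdm X 2 i

/-- `d_n^i`: minimum cardinality of an admissible set with three filled hubs and `i` cross hubs. -/
def dq (X : GraphGen) (i : ℕ) : ℕ := minAdm X 3 i

end

namespace GraphGen

variable {X : GraphGen}

/-- A vertex of `X`, seen in the next generation. -/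
def old (v : X.V) : (pfwStep X).V := Sum.inl v

/-- The new vertex attached to an edge of `X` in the next generation. -/
def mid (e : {e : Sym2 X.V // e ∈ X.edges}) : (pfwStep X).V := Sum.inr e

theorem old_injective : Function.Injective (old (X := X)) := Sum.inl_injective

@[simp] theorem old_inj {v w : X.V} : old v = old w ↔ v = w := old_injective.eq_iff

@[simp] theorem mid_inj {e f : {e : Sym2 X.V // e ∈ X.edges}} : mid e = mid f ↔ e = f :=
  Sum.inr_injective.eq_iff

@[simp] theorem old_ne_mid {v : X.V} {e : {e : Sym2 X.V // e ∈ X.edges}} : old v ≠ mid e :=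
  Sum.inl_ne_inr

@[simp] theorem mid_ne_old {v : X.V} {e : {e : Sym2 X.V // e ∈ X.edges}} : mid e ≠ old v :=
  Sum.inr_ne_inl

theorem step_cases (x : (pfwStep X).V) : (∃ v, x = old v) ∨ ∃ e, x = mid e := by
  rcases x with v | e
  · exact Or.inl ⟨v, rfl⟩
  · exact Or.inr ⟨e, rfl⟩

@[simp] theorem hubs_step (i : Fin 3) : (pfwStep X).hubs i = old (X.hubs i) := rfl

theorem mem_edges_step {q : Sym2 (pfwStep X).V} :
    q ∈ (pfwStep X).edges ↔
      (∃ e ∈ X.edges, e.map old = q) ∨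
        ∃ e : {e : Sym2 X.V // e ∈ X.edges}, ∃ v ∈ e.1, s(old v, mid e) = q := by
  refine (Finset.mem_union (α := Sym2 (X.V ⊕ {e : Sym2 X.V // e ∈ X.edges}))).trans
    (or_congr Finset.mem_image (Finset.mem_biUnion.trans ⟨?_, ?_⟩))
  · rintro ⟨e, -, h⟩
    obtain ⟨v, hv, h⟩ := Finset.mem_image.1 h
    exact ⟨e, v, (Finset.mem_filter.1 hv).2, h⟩
  · rintro ⟨e, v, hv, h⟩
    exact ⟨e, Finset.mem_attach _ _,
      Finset.mem_image.2 ⟨v, Finset.mem_filter.2 ⟨Finset.mem_univ _, hv⟩, h⟩⟩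

theorem map_old_mem {e : Sym2 X.V} (he : e ∈ X.edges) : e.map old ∈ (pfwStep X).edges :=
  mem_edges_step.2 (Or.inl ⟨e, he, rfl⟩)

theorem old_mid_mem {e : {e : Sym2 X.V // e ∈ X.edges}} {v : X.V} (hv : v ∈ e.1) :
    s(old v, mid e) ∈ (pfwStep X).edges :=
  mem_edges_step.2 (Or.inr ⟨e, v, hv, rfl⟩)

/-- The edges of `X` are not loops and its hubs are pairwise adjacent. -/
structure Good (X : GraphGen) : Prop where
  not_isDiag : ∀ e ∈ X.edges, ¬ e.IsDiag
  hub_adj : ∀ i j, i ≠ j → s(X.hubs i, X.hubs j) ∈ X.edges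

theorem Good.hubs_injective (hX : X.Good) : Function.Injective X.hubs := by
  intro i j h
  by_contra hij
  exact hX.not_isDiag _ (hX.hub_adj i j hij) (Sym2.mk_isDiag_iff.2 h)

theorem Good.step (hX : X.Good) : (pfwStep X).Good where
  not_isDiag q hq := by
    rcases mem_edges_step.1 hq with ⟨e, he, rfl⟩ | ⟨e, v, hv, rfl⟩
    · rw [Sym2.isDiag_map old_injective]
      exact hX.not_isDiag e he
    · rw [Sym2.mk_isDiag_iff]
      exact old_ne_mid
  hub_adj i j hij := map_old_mem (hX.hub_adj i j hij)

theorem good_triangle : triangle.Good where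
  not_isDiag := by
    have h : ∀ e ∈ ({s(0, 1), s(0, 2), s(1, 2)} : Finset (Sym2 (Fin 3))), ¬ e.IsDiag := by decide
    exact h
  hub_adj i j hij := by
    have h : ∀ i j : Fin 3, i ≠ j →
        s(i, j) ∈ ({s(0, 1), s(0, 2), s(1, 2)} : Finset (Sym2 (Fin 3))) := by decide
    exact h i j hij

theorem card_edges_step (hX : X.Good) : (pfwStep X).edges.card = 3 * X.edges.card := by
  have hdisj : Disjoint (X.edges.image (Sym2.map (old (X := X))))
      (X.edges.attach.biUnion fun e =>
        (e : Sym2 X.V).toFinset.image fun v => s(old v, mid e)) := by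
    rw [Finset.disjoint_left]
    intro q hq hq'
    obtain ⟨e, -, rfl⟩ := Finset.mem_image.1 hq
    obtain ⟨f, -, hf⟩ := Finset.mem_biUnion.1 hq'
    obtain ⟨v, -, hv⟩ := Finset.mem_image.1 hf
    have hm : mid f ∈ e.map old := hv ▸ Sym2.mem_mk_right _ _
    obtain ⟨a, -, ha⟩ := Sym2.mem_map.1 hm
    exact old_ne_mid ha
  have hedges : (pfwStep X).edges = X.edges.image (Sym2.map (old (X := X))) ∪
      X.edges.attach.biUnion fun e =>
        (e : Sym2 X.V).toFinset.image fun v => s(old v, mid e) := by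
    ext q
    rw [mem_edges_step]
    simp [Sym2.mem_toFinset]
  rw [hedges, Finset.card_union_of_disjoint hdisj,
    Finset.card_image_of_injective _ (Sym2.map.injective old_injective), Finset.card_biUnion]
  · have h2 : ∀ e ∈ X.edges.attach,
        ((e : Sym2 X.V).toFinset.image fun v => s(old v, mid e)).card = 2 := by
      intro e _
      rw [Finset.card_image_of_injective,
        Sym2.card_toFinset_of_not_isDiag _ (hX.not_isDiag _ e.2)]
      intro v w h
      simpa using h
    rw [Finset.sum_congr rfl h2, Finset.sum_const, Finset.card_attach, smul_eq_mul]
    ring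
  · intro e _ f _ hef
    rw [Function.onFun, Finset.disjoint_left]
    intro q hq hq'
    obtain ⟨v, -, rfl⟩ := Finset.mem_image.1 hq
    obtain ⟨w, -, hw⟩ := Finset.mem_image.1 hq'
    simp only [Sym2.eq_iff, old_inj, mid_inj, old_ne_mid, mid_ne_old, and_false, or_false] at hw
    exact hef hw.2.symm

/-- In the second next generation, `y` is the vertex attached to the edge `e`, or a vertex
attached to an edge joining it to an end of `e`. -/
def Near (e : {e : Sym2 X.V // e ∈ X.edges}) (y : (pfwStep (pfwStep X)).V) : Prop :=
  y = old (mid e) ∨ ∃ f a, y = mid f ∧ f.1 = s(old a, mid e)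

theorem Near.eq {e e' : {e : Sym2 X.V // e ∈ X.edges}} {x y : (pfwStep (pfwStep X)).V}
    {q : Sym2 (pfwStep (pfwStep X)).V} (hq : q ∈ (pfwStep (pfwStep X)).edges)
    (hx : x ∈ q) (hy : y ∈ q) (hex : Near e x) (hey : Near e' y) : e = e' := by
  have key : ∀ {f : {f : Sym2 (pfwStep X).V // f ∈ (pfwStep X).edges}}
      {e e' : {e : Sym2 X.V // e ∈ X.edges}}, mid e ∈ f.1 → mid e' ∈ f.1 → e = e' := by
    rintro ⟨f, hf⟩ e e' he he'
    rcases mem_edges_step.1 hf with ⟨g, -, rfl⟩ | ⟨g, v, -, rfl⟩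
    · obtain ⟨a, -, ha⟩ := Sym2.mem_map.1 he
      exact absurd ha old_ne_mid
    · simp only [Sym2.mem_iff, mid_ne_old, mid_inj, false_or] at he he'
      rw [he, he']
  rcases mem_edges_step.1 hq with ⟨g, hg, rfl⟩ | ⟨g, v, hv, rfl⟩
  · obtain ⟨a, ha, rfl⟩ := Sym2.mem_map.1 hx
    obtain ⟨b, hb, rfl⟩ := Sym2.mem_map.1 hy
    simp only [Near, old_inj, old_ne_mid, false_and, exists_false, or_false] at hex hey
    subst hex hey
    exact key (f := ⟨g, hg⟩) ha hb
  · have near_mem : ∀ {e : {e : Sym2 X.V // e ∈ X.edges}} {z : (pfwStep (pfwStep X)).V},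
        z ∈ s(old v, mid g) → Near e z → mid e ∈ g.1 := by
      rintro e z hz (rfl | ⟨f, a, rfl, hf⟩)
      · simp only [Sym2.mem_iff, old_inj, old_ne_mid, or_false] at hz
        exact hz ▸ hv
      · simp only [Sym2.mem_iff, mid_inj, mid_ne_old, false_or] at hz
        rw [← hz, hf]
        exact Sym2.mem_mk_right _ _
    exact key (near_mem hx hex) (near_mem hy hey)

theorem _root_.Dominated.exists_mem {F : Finset (Sym2 X.V)} {e : Sym2 X.V}
    (h : Dominated X F e) : ∃ f ∈ F, ∃ v, v ∈ e ∧ v ∈ f := by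
  rcases h with h | h
  · exact ⟨e, h, e.out.1, e.out_fst_mem, e.out_fst_mem⟩
  · exact h

/-- Each edge of `X` contributes at least one edge to any admissible set two generations later. -/
theorem card_le_of_admissible {F : Finset (Sym2 (pfwStep (pfwStep X)).V)}
    (hF : Admissible (pfwStep (pfwStep X)) F) : X.edges.card ≤ F.card := by
  have key : ∀ e : {e : Sym2 X.V // e ∈ X.edges}, ∃ q ∈ F, ∃ x ∈ q, Near e x := by
    intro e
    let f : {f : Sym2 (pfwStep X).V // f ∈ (pfwStep X).edges} :=
      ⟨s(old e.1.out.1, mid e), old_mid_mem e.1.out_fst_mem⟩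
    have hf : s(old (mid e), mid f) ∈ (pfwStep (pfwStep X)).edges :=
      old_mid_mem (Sym2.mem_mk_right _ _)
    have hdom : Dominated _ F s(old (mid e), mid f) := by
      by_contra h
      obtain ⟨i, -, hi⟩ := hF.2 _ hf h
      simp at hi
    obtain ⟨q, hq, x, hx, hxq⟩ := hdom.exists_mem
    refine ⟨q, hq, x, hxq, ?_⟩
    rcases Sym2.mem_iff.1 hx with rfl | rfl
    · exact Or.inl rfl
    · exact Or.inr ⟨f, _, rfl, rfl⟩
  choose q hqF x hx hn using key
  rw [← Finset.card_attach]
  refine Finset.card_le_card_of_injOn q (fun e _ => hqF e) ?_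
  intro e _ e' _ h
  exact Near.eq (hF.1 (hqF e)) (hx e) (h ▸ hx e') (hn e) (hn e')

theorem numFilled_eq {F : Finset (Sym2 X.V)} {s : Finset (Fin 3)}
    (h : ∀ i, FilledHub X F i ↔ i ∈ s) : numFilled X F = s.card := by
  unfold numFilled
  congr 1
  ext i
  simp [h]

theorem numCross_eq {F : Finset (Sym2 X.V)} {s : Finset (Fin 3)}
    (h : ∀ i, CrossHub X F i ↔ i ∈ s) : numCross X F = s.card := by
  unfold numCross
  congr 1
  ext i
  simp [h]

/-- There is an admissible set with `nf` filled and `i` cross hubs. -/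
def Feasible (X : GraphGen) (nf i : ℕ) : Prop :=
  ∃ F, Admissible X F ∧ numFilled X F = nf ∧ numCross X F = i

theorem Feasible.card_le_minAdm {nf i : ℕ} (h : Feasible (pfwStep (pfwStep X)) nf i) :
    X.edges.card ≤ minAdm (pfwStep (pfwStep X)) nf i := by
  obtain ⟨F, hF, hf, hc⟩ := h
  obtain ⟨F', hF', -, -, hcard⟩ := Nat.sInf_mem
    (s := {k | ∃ F, Admissible (pfwStep (pfwStep X)) F ∧ numFilled (pfwStep (pfwStep X)) F = nf ∧
      numCross (pfwStep (pfwStep X)) F = i ∧ F.card = k}) ⟨_, F, hF, hf, hc, rfl⟩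
  exact (card_le_of_admissible hF').trans hcard.le

/-- The edges of `X` avoiding the hubs in `H`. -/
noncomputable def avoiding (X : GraphGen) (H : Finset (Fin 3)) : Finset (Sym2 X.V) :=
  X.edges.filter fun q => ∀ i ∈ H, X.hubs i ∉ q

theorem not_filledHub_avoiding {H : Finset (Fin 3)} {i : Fin 3} (hi : i ∈ H) :
    ¬ FilledHub X (X.avoiding H) i := by
  rintro ⟨f, hf, hif⟩
  exact (Finset.mem_filter.1 hf).2 i hi hif

theorem admissible_avoiding (H : Finset (Fin 3)) : Admissible X (X.avoiding H) := by
  refine ⟨Finset.filter_subset _ _, fun e he hd => ?_⟩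
  have he' : e ∉ X.avoiding H := fun h => hd (Or.inl h)
  simp only [avoiding, Finset.mem_filter, he, true_and, not_forall, not_not] at he'
  obtain ⟨i, hi, hie⟩ := he'
  exact ⟨i, ⟨not_filledHub_avoiding hi, e, he, hie, hd⟩, hie⟩

theorem old_mid_mem_avoiding {H : Finset (Fin 3)} {e : {e : Sym2 X.V // e ∈ X.edges}} {v : X.V}
    (hv : v ∈ e.1) (hH : ∀ i ∈ H, v ≠ X.hubs i) :
    s(old v, mid e) ∈ (pfwStep X).avoiding H := by
  refine Finset.mem_filter.2 ⟨old_mid_mem hv, fun i hi h => ?_⟩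
  simp only [hubs_step, Sym2.mem_iff, old_inj, old_ne_mid, or_false] at h
  exact hH i hi h.symm

theorem filledHub_avoiding_iff (hX : X.Good) {H : Finset (Fin 3)} {i : Fin 3} :
    FilledHub (pfwStep X) ((pfwStep X).avoiding H) i ↔ i ∉ H := by
  refine ⟨fun h hi => not_filledHub_avoiding hi h, fun hi => ?_⟩
  have hadj := hX.hub_adj i (i + 1) (by simp)
  refine ⟨s(old (X.hubs i), mid ⟨_, hadj⟩),
    old_mid_mem_avoiding (Sym2.mem_mk_left _ _) ?_, Sym2.mem_mk_left _ _⟩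
  rintro j hj h
  exact hi (hX.hubs_injective h ▸ hj)

theorem feasible_three_zero (hX : X.Good) : Feasible (pfwStep X) 3 0 := by
  refine ⟨_, admissible_avoiding ∅, ?_, ?_⟩
  · rw [numFilled_eq (s := Finset.univ) fun i => by simp [filledHub_avoiding_iff hX]]
    rfl
  · rw [numCross_eq (s := ∅) fun i => by simp [CrossHub, filledHub_avoiding_iff hX]]
    rfl

theorem feasible_one_two (hX : X.Good) : Feasible (pfwStep X) 1 2 := by
  refine ⟨_, admissible_avoiding {1, 2}, ?_, ?_⟩
  · rw [numFilled_eq (s := {0}) fun i => by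
      rw [filledHub_avoiding_iff hX]; revert i; decide]
    rfl
  · rw [numCross_eq (s := {1, 2}) fun i => ?_]
    · rfl
    · rw [CrossHub, filledHub_avoiding_iff hX, not_not, and_iff_left_iff_imp]
      intro hi
      refine ⟨s((pfwStep X).hubs 1, (pfwStep X).hubs 2), hX.step.hub_adj 1 2 (by decide), ?_, ?_⟩
      · simp only [Finset.mem_insert, Finset.mem_singleton] at hi
        rcases hi with rfl | rfl
        · exact Sym2.mem_mk_left _ _
        · exact Sym2.mem_mk_right _ _
      · intro h
        obtain ⟨f, hf, v, hv, hvf⟩ := h.exists_mem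
        rcases Sym2.mem_iff.1 hv with rfl | rfl
        · exact (Finset.mem_filter.1 hf).2 1 (by decide) hvf
        · exact (Finset.mem_filter.1 hf).2 2 (by decide) hvf

theorem feasible_two_zero (hX : X.Good) : Feasible (pfwStep X) 2 0 := by
  have dom : ∀ (e : {e : Sym2 X.V // e ∈ X.edges}), X.hubs 2 ∈ e.1 →
      ∃ b, e.1 = s(X.hubs 2, b) ∧ s(old b, mid e) ∈ (pfwStep X).avoiding {2} := by
    rintro ⟨e, he⟩ h
    obtain ⟨b, rfl⟩ := Sym2.mem_iff_exists.1 h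
    refine ⟨b, rfl, old_mid_mem_avoiding (Sym2.mem_mk_right _ _) ?_⟩
    rintro i hi rfl
    rw [Finset.mem_singleton.1 hi] at he
    exact hX.not_isDiag _ he (Sym2.mk_isDiag_iff.2 rfl)
  refine ⟨_, admissible_avoiding {2}, ?_, ?_⟩
  · rw [numFilled_eq (s := {0, 1}) fun i => by
      rw [filledHub_avoiding_iff hX]; revert i; decide]
    rfl
  · rw [numCross_eq (s := ∅) fun i => ?_]
    · rfl
    · refine iff_of_false ?_ (Finset.notMem_empty i)
      rintro ⟨hi, q, hq, hiq, hd⟩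
      rw [filledHub_avoiding_iff hX, not_not, Finset.mem_singleton] at hi
      subst hi
      apply hd
      rcases mem_edges_step.1 hq with ⟨e, he, rfl⟩ | ⟨e, v, hv, rfl⟩
      · obtain ⟨a, ha, haq⟩ := Sym2.mem_map.1 hiq
        obtain rfl := old_injective haq
        obtain ⟨b, hb, hbF⟩ := dom ⟨e, he⟩ ha
        refine Or.inr ⟨_, hbF, old b, ?_, Sym2.mem_mk_left _ _⟩
        rw [show e = s(X.hubs 2, b) from hb]
        exact Sym2.mem_mk_right _ _
      · simp only [hubs_step, Sym2.mem_iff, old_inj, old_ne_mid, or_false] at hiq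
        subst hiq
        obtain ⟨b, -, hbF⟩ := dom e hv
        exact Or.inr ⟨_, hbF, mid e, Sym2.mem_mk_right _ _, Sym2.mem_mk_right _ _⟩

/-- `o` orients every edge of `X` towards one of its ends, so that the vertices of indegree zero
are exactly the third hub. -/
structure Orients (X : GraphGen) (o : Sym2 X.V → X.V) : Prop where
  mem : ∀ e ∈ X.edges, o e ∈ e
  ne_hub : ∀ e ∈ X.edges, o e ≠ X.hubs 2
  exists_eq : ∀ v, v ≠ X.hubs 2 → ∃ e ∈ X.edges, o e = v

theorem exists_orients_triangle : ∃ o, Orients triangle o := by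
  let o : Sym2 (Fin 3) → Fin 3 := fun e => if e = s(1, 2) then 1 else 0
  have h12 : s((1 : Fin 3), 2) ∈ triangle.edges := good_triangle.hub_adj 1 2 (by decide)
  have h01 : s((0 : Fin 3), 1) ∈ triangle.edges := good_triangle.hub_adj 0 1 (by decide)
  have hmem : ∀ e ∈ ({s(0, 1), s(0, 2), s(1, 2)} : Finset (Sym2 (Fin 3))), o e ∈ e := by decide
  have hne : ∀ e, o e ≠ 2 := fun e => by
    dsimp only [o]
    split_ifs <;> decide
  have h0 : o s(0, 1) = 0 := by decide
  have h1 : o s(1, 2) = 1 := by decide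
  have hcases : ∀ v : Fin 3, v ≠ 2 → v = 0 ∨ v = 1 := by decide
  refine ⟨o, hmem, fun e _ => hne e, fun v hv => ?_⟩
  rcases hcases v hv with rfl | rfl
  · exact ⟨_, h01, h0⟩
  · exact ⟨_, h12, h1⟩

theorem Orients.step {o : Sym2 X.V → X.V} (ho : Orients X o) :
    ∃ o', Orients (pfwStep X) o' := by
  have key : ∀ q : Sym2 (pfwStep X).V, ∃ x : (pfwStep X).V, q ∈ (pfwStep X).edges →
      x ∈ q ∧ x ≠ old (X.hubs 2) ∧ (∀ e, mid e ∈ q → x = mid e) ∧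
        ∀ e ∈ X.edges, e.map old = q → x = old (o e) := by
    intro q
    by_cases hq : q ∈ (pfwStep X).edges
    · rcases mem_edges_step.1 hq with ⟨e, he, rfl⟩ | ⟨e, v, hv, rfl⟩
      · refine ⟨old (o e), fun _ => ⟨Sym2.mem_map.2 ⟨_, ho.mem e he, rfl⟩,
          fun h => ho.ne_hub e he (old_injective h), fun f hf => ?_, fun f _ hfe => ?_⟩⟩
        · obtain ⟨a, -, ha⟩ := Sym2.mem_map.1 hf
          exact absurd ha old_ne_mid
        · rw [Sym2.map.injective old_injective hfe]
      · refine ⟨mid e, fun _ => ⟨Sym2.mem_mk_right _ _, mid_ne_old, fun f hf => ?_,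
          fun f _ hfe => ?_⟩⟩
        · simpa [eq_comm] using Sym2.mem_iff.1 hf
        · have hm : mid e ∈ f.map old := hfe ▸ Sym2.mem_mk_right _ _
          obtain ⟨a, -, ha⟩ := Sym2.mem_map.1 hm
          exact absurd ha old_ne_mid
    · exact ⟨old (X.hubs 2), fun h => absurd h hq⟩
  choose o' ho' using key
  refine ⟨o', fun q hq => (ho' q hq).1, fun q hq => (ho' q hq).2.1, fun x hx => ?_⟩
  rcases step_cases x with ⟨v, rfl⟩ | ⟨e, rfl⟩
  · obtain ⟨e, he, rfl⟩ := ho.exists_eq v fun h => hx (congrArg old h)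
    exact ⟨_, map_old_mem he, (ho' _ (map_old_mem he)).2.2.2 e he rfl⟩
  · have hq := old_mid_mem (e := e) e.1.out_fst_mem
    exact ⟨_, hq, (ho' _ hq).2.2.1 e (Sym2.mem_mk_right _ _)⟩

/-- The edges, two generations later, joining the vertex attached to each edge of `X` to the end
chosen by `o`. -/
noncomputable def orientedEdges (X : GraphGen) (o : Sym2 X.V → X.V) : Finset (Sym2 (pfwStep (pfwStep X)).V) :=
  X.edges.attach.image fun e => s(old (old (o e.1)), old (mid e))

theorem mem_orientedEdges {o : Sym2 X.V → X.V} (e : {e : Sym2 X.V // e ∈ X.edges}) :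
    s(old (old (o e.1)), old (mid e)) ∈ X.orientedEdges o :=
  Finset.mem_image_of_mem _ (Finset.mem_attach _ e)

theorem Orients.old_old_touched_iff {o : Sym2 X.V → X.V} (ho : Orients X o) {v : X.V} :
    (∃ f ∈ X.orientedEdges o, old (old v) ∈ f) ↔ v ≠ X.hubs 2 := by
  constructor
  · rintro ⟨f, hf, hv⟩
    obtain ⟨e, -, rfl⟩ := Finset.mem_image.1 hf
    simp only [Sym2.mem_iff, old_inj, old_ne_mid, or_false] at hv
    exact hv ▸ ho.ne_hub e e.2
  · intro hv
    obtain ⟨e, he, rfl⟩ := ho.exists_eq v hv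
    exact ⟨_, mem_orientedEdges ⟨e, he⟩, Sym2.mem_mk_left _ _⟩

theorem Orients.hub_mem_of_not_dominated {o : Sym2 X.V → X.V} (ho : Orients X o)
    {q : Sym2 (pfwStep (pfwStep X)).V} (hq : q ∈ (pfwStep (pfwStep X)).edges)
    (hd : ¬ Dominated _ (X.orientedEdges o) q) : old (old (X.hubs 2)) ∈ q := by
  have hold : ∀ x : (pfwStep X).V, old x ∈ q → x = old (X.hubs 2) := by
    intro x hx
    rcases step_cases x with ⟨v, rfl⟩ | ⟨e, rfl⟩
    · by_contra hv
      obtain ⟨f, hf, hvf⟩ := ho.old_old_touched_iff.2 fun h => hv (congrArg old h)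
      exact hd (Or.inr ⟨f, hf, _, hx, hvf⟩)
    · exact absurd (Or.inr ⟨_, mem_orientedEdges e, _, hx, Sym2.mem_mk_right _ _⟩) hd
  rcases mem_edges_step.1 hq with ⟨e, -, rfl⟩ | ⟨e, v, -, rfl⟩
  · have hm : old e.out.1 ∈ e.map old := Sym2.mem_map.2 ⟨_, e.out_fst_mem, rfl⟩
    exact hold _ hm ▸ hm
  · exact hold v (Sym2.mem_mk_left _ _) ▸ Sym2.mem_mk_left _ _

theorem Orients.minAdm_two_one (hX : X.Good) {o : Sym2 X.V → X.V} (ho : Orients X o) :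
    minAdm (pfwStep (pfwStep X)) 2 1 = X.edges.card := by
  have hfilled : ∀ i, FilledHub (pfwStep (pfwStep X)) (X.orientedEdges o) i ↔ i ≠ 2 := fun i =>
    ho.old_old_touched_iff.trans hX.hubs_injective.ne_iff
  have hcross : ∀ i, CrossHub (pfwStep (pfwStep X)) (X.orientedEdges o) i ↔ i = 2 := by
    intro i
    rw [CrossHub, hfilled, not_not, and_iff_left_iff_imp]
    rintro rfl
    let e : {e : Sym2 X.V // e ∈ X.edges} := ⟨_, hX.hub_adj 2 0 (by decide)⟩
    have he : X.hubs 2 ∈ e.1 := Sym2.mem_mk_left _ _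
    refine ⟨s(old (old (X.hubs 2)), mid ⟨_, old_mid_mem he⟩),
      old_mid_mem (Sym2.mem_mk_left _ _), Sym2.mem_mk_left _ _, fun h => ?_⟩
    obtain ⟨f, hf, x, hx, hxf⟩ := h.exists_mem
    rcases Sym2.mem_iff.1 hx with rfl | rfl
    · exact ho.old_old_touched_iff.1 ⟨f, hf, hxf⟩ rfl
    · obtain ⟨e, -, rfl⟩ := Finset.mem_image.1 hf
      simp at hxf
  have hadm : Admissible (pfwStep (pfwStep X)) (X.orientedEdges o) := by
    refine ⟨fun q hq => ?_, fun q hq hd => ⟨2, (hcross 2).2 rfl, ?_⟩⟩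
    · obtain ⟨e, -, rfl⟩ := Finset.mem_image.1 hq
      exact map_old_mem (old_mid_mem (ho.mem e e.2))
    · exact ho.hub_mem_of_not_dominated hq hd
  have hnf : numFilled _ (X.orientedEdges o) = 2 :=
    numFilled_eq (s := {0, 1}) fun i => by rw [hfilled]; revert i; decide
  have hnc : numCross _ (X.orientedEdges o) = 1 :=
    numCross_eq (s := {2}) fun i => by rw [hcross, Finset.mem_singleton]
  refine le_antisymm ?_ (Feasible.card_le_minAdm ⟨_, hadm, hnf, hnc⟩)
  have hle : minAdm _ 2 1 ≤ (X.orientedEdges o).card := Nat.sInf_le ⟨_, hadm, hnf, hnc, rfl⟩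
  exact hle.trans (Finset.card_image_le.trans Finset.card_attach.le)

theorem good_pfwAux (k : ℕ) : (pfwAux k).Good := by
  induction k with
  | zero => exact good_triangle
  | succ k ih => exact ih.step

theorem exists_orients_pfwAux (k : ℕ) : ∃ o, Orients (pfwAux k) o := by
  induction k with
  | zero => exact exists_orients_triangle
  | succ k ih => exact ih.elim fun _ ho => ho.step

end GraphGen

open GraphGen in
/-- the recursion for `c_{n+1}^1` in the pseudofractal scale-free web. -/
theorem pfw_c1_recursion (n : ℕ) (hn : 3 ≤ n) :
    cq (pfw (n + 1)) 1 =
      min (3 * cq (pfw n) 1)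
      (min (2 * cq (pfw n) 1 + cq (pfw n) 0)
      (min (2 * cq (pfw n) 1 + dq (pfw n) 0)
      (min (cq (pfw n) 1 + 2 * cq (pfw n) 0)
      (min (cq (pfw n) 1 + cq (pfw n) 0 + dq (pfw n) 0)
      (min (bq (pfw n) 2 + cq (pfw n) 0 + cq (pfw n) 1)
      (min (bq (pfw n) 2 + cq (pfw n) 0 + dq (pfw n) 0)
      (min (bq (pfw n) 2 + 2 * cq (pfw n) 0)
      (min (2 * bq (pfw n) 2 + cq (pfw n) 0)
      (min (2 * bq (pfw n) 2 + dq (pfw n) 0)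
      (min (bq (pfw n) 2 + 2 * cq (pfw n) 1)
      (bq (pfw n) 2 + cq (pfw n) 1 + dq (pfw n) 0))))))))))) := by
  obtain ⟨k, rfl⟩ := Nat.exists_eq_add_of_le' hn
  have hX := good_pfwAux k
  obtain ⟨o, ho⟩ := exists_orients_pfwAux k
  obtain ⟨o', ho'⟩ := exists_orients_pfwAux (k + 1)
  have hnext : cq (pfw (k + 3 + 1)) 1 = 3 * (pfwAux k).edges.card :=
    (ho'.minAdm_two_one hX.step).trans (card_edges_step hX)
  have hc1 : cq (pfw (k + 3)) 1 = (pfwAux k).edges.card := ho.minAdm_two_one hX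
  have hb2 : (pfwAux k).edges.card ≤ bq (pfw (k + 3)) 2 :=
    (feasible_one_two hX.step).card_le_minAdm
  have hc0 : (pfwAux k).edges.card ≤ cq (pfw (k + 3)) 0 :=
    (feasible_two_zero hX.step).card_le_minAdm
  have hd0 : (pfwAux k).edges.card ≤ dq (pfw (k + 3)) 0 :=
    (feasible_three_zero hX.step).card_le_minAdm
  rw [hnext, hc1, eq_comm, min_eq_left]
  simp only [le_min_iff]
  omega
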